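/- arXiv:1611.08423 — 2 statements merged into one kernel-verified Lean document; each statement's English description precedes it below -/
import Mathlib

section
/- Let σ ≥ 0. The function (x, y) ↦ B_σ(x, y) is logarithmically convex on (0, ∞) × (0, ∞); that is, for all x₁, y₁, x₂, y₂ > 0 and α₁, α₂ > 0 with α₁ + α₂ = 1, B_σ(α₁ x₁ + α₂ x₂, α₁ y₁ + α₂ y₂) ≤ B_σ(x₁, y₁)^{α₁} · B_σ(x₂, y₂)^{α₂}. -/
open Real intervalIntegral

/-- The extended beta function `B_σ(x, y) = ∫₀¹ t^(x-1) (1-t)^(y-1) exp(-σ/(t(1-t))) dt`. -/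
noncomputable def extBeta (σ x y : ℝ) : ℝ :=
  ∫ t in (0:ℝ)..1, t ^ (x - 1) * (1 - t) ^ (y - 1) * Real.exp (-σ / (t * (1 - t)))

open MeasureTheory Set

/-- The integrand of the extended beta function. -/
noncomputable def extBetaIntegrand (σ x y t : ℝ) : ℝ :=
  t ^ (x - 1) * (1 - t) ^ (y - 1) * Real.exp (-σ / (t * (1 - t)))

lemma extBeta_eq_setIntegral (σ x y : ℝ) :
    extBeta σ x y = ∫ t in Ioo (0 : ℝ) 1, extBetaIntegrand σ x y t := by
  rw [extBeta, intervalIntegral.integral_of_le zero_le_one, integral_Ioc_eq_integral_Ioo]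
  rfl

lemma measurable_extBetaIntegrand (σ x y : ℝ) : Measurable (extBetaIntegrand σ x y) := by
  unfold extBetaIntegrand
  fun_prop

lemma extBetaIntegrand_nonneg {t : ℝ} (σ x y : ℝ) (ht : t ∈ Ioo (0 : ℝ) 1) :
    0 ≤ extBetaIntegrand σ x y t := by
  have h0 := ht.1.le
  have h1 : 0 ≤ 1 - t := sub_nonneg.2 ht.2.le
  unfold extBetaIntegrand
  positivity

lemma integrableOn_rpow_mul_one_sub_rpow {x y : ℝ} (hx : 0 < x) (hy : 0 < y) :
    IntegrableOn (fun t : ℝ => t ^ (x - 1) * (1 - t) ^ (y - 1)) (Ioo 0 1) := by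
  have h := Complex.betaIntegral_convergent (u := x) (v := y) (by simpa) (by simpa)
  rw [intervalIntegrable_iff_integrableOn_Ioo_of_le zero_le_one] at h
  refine IntegrableOn.congr_fun h.norm (fun t ht => ?_) measurableSet_Ioo
  have h1 : 0 < 1 - t := sub_pos.2 ht.2
  have e : (1 - (t : ℂ)) = ((1 - t : ℝ) : ℂ) := by push_cast; rfl
  rw [norm_mul, e, Complex.norm_cpow_eq_rpow_re_of_pos ht.1,
    Complex.norm_cpow_eq_rpow_re_of_pos h1]
  simp

lemma integrableOn_extBetaIntegrand {σ x y : ℝ} (hσ : 0 ≤ σ) (hx : 0 < x) (hy : 0 < y) :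
    IntegrableOn (extBetaIntegrand σ x y) (Ioo 0 1) := by
  refine (integrableOn_rpow_mul_one_sub_rpow hx hy).mono'
    (measurable_extBetaIntegrand σ x y).aestronglyMeasurable ?_
  filter_upwards [ae_restrict_mem measurableSet_Ioo] with t ht
  rw [Real.norm_of_nonneg (extBetaIntegrand_nonneg σ x y ht)]
  have h0 : 0 < t := ht.1
  have h1 : 0 < 1 - t := sub_pos.2 ht.2
  refine mul_le_of_le_one_right (by positivity) (Real.exp_le_one_iff.2 ?_)
  exact div_nonpos_of_nonpos_of_nonneg (neg_nonpos.2 hσ) (by positivity)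

lemma extBetaIntegrand_convexComb {σ t x₁ y₁ x₂ y₂ α₁ α₂ : ℝ} (ht : t ∈ Ioo (0 : ℝ) 1)
    (hα : α₁ + α₂ = 1) :
    extBetaIntegrand σ (α₁ * x₁ + α₂ * x₂) (α₁ * y₁ + α₂ * y₂) t =
      extBetaIntegrand σ x₁ y₁ t ^ α₁ * extBetaIntegrand σ x₂ y₂ t ^ α₂ := by
  have h0 : 0 < t := ht.1
  have h1 : 0 < 1 - t := sub_pos.2 ht.2
  obtain rfl : α₂ = 1 - α₁ := by linarith
  simp only [extBetaIntegrand, Real.rpow_def_of_pos h0, Real.rpow_def_of_pos h1, ← Real.exp_add,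
    ← Real.exp_mul]
  congr 1
  ring

lemma memLp_rpow_of_integrable {X : Type*} [MeasurableSpace X] {μ : Measure X} {f : X → ℝ} {α : ℝ}
    (hα : 0 < α) (hf : Integrable f μ) (hf0 : 0 ≤ᵐ[μ] f) :
    MemLp (fun a => f a ^ α) (ENNReal.ofReal α⁻¹) μ := by
  have hm : AEStronglyMeasurable (fun a => f a ^ α) μ :=
    (hf.aemeasurable.pow_const α).aestronglyMeasurable
  rw [← integrable_norm_rpow_iff hm (by simpa using hα) ENNReal.ofReal_ne_top,
    ENNReal.toReal_ofReal (inv_pos.2 hα).le]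
  refine hf.congr ?_
  filter_upwards [hf0] with a ha
  rw [Real.norm_of_nonneg (Real.rpow_nonneg ha α), Real.rpow_rpow_inv ha hα.ne']

/-- Hölder's inequality for a geometric mean of two nonnegative integrable functions. -/
lemma integral_rpow_mul_rpow_le {X : Type*} [MeasurableSpace X] {μ : Measure X} {f g : X → ℝ}
    {α β : ℝ} (hα : 0 < α) (hβ : 0 < β) (hαβ : α + β = 1) (hf : Integrable f μ)
    (hg : Integrable g μ) (hf0 : 0 ≤ᵐ[μ] f) (hg0 : 0 ≤ᵐ[μ] g) :
    ∫ a, f a ^ α * g a ^ β ∂μ ≤ (∫ a, f a ∂μ) ^ α * (∫ a, g a ∂μ) ^ β := by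
  have hpq : α⁻¹.HolderConjugate β⁻¹ :=
    Real.holderConjugate_iff.2 ⟨(one_lt_inv₀ hα).2 (by linarith), by simpa using hαβ⟩
  have h := integral_mul_le_Lp_mul_Lq_of_nonneg hpq (μ := μ)
    (hf0.mono fun a ha => Real.rpow_nonneg ha α) (hg0.mono fun a ha => Real.rpow_nonneg ha β)
    (memLp_rpow_of_integrable hα hf hf0) (memLp_rpow_of_integrable hβ hg hg0)
  have ef : ∫ a, (f a ^ α) ^ α⁻¹ ∂μ = ∫ a, f a ∂μ :=
    integral_congr_ae (hf0.mono fun a ha => Real.rpow_rpow_inv ha hα.ne')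
  have eg : ∫ a, (g a ^ β) ^ β⁻¹ ∂μ = ∫ a, g a ∂μ :=
    integral_congr_ae (hg0.mono fun a ha => Real.rpow_rpow_inv ha hβ.ne')
  simpa only [ef, eg, one_div, inv_inv] using h

/-- (x, y) ↦ B_σ(x, y) is logarithmically convex on (0, ∞) × (0, ∞). -/
theorem extBeta_logConvex_in_xy (σ : ℝ) (hσ : 0 ≤ σ) :
    ∀ x₁ y₁ x₂ y₂ α₁ α₂ : ℝ, 0 < x₁ → 0 < y₁ → 0 < x₂ → 0 < y₂ →
      0 < α₁ → 0 < α₂ → α₁ + α₂ = 1 →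
      extBeta σ (α₁ * x₁ + α₂ * x₂) (α₁ * y₁ + α₂ * y₂) ≤
        extBeta σ x₁ y₁ ^ α₁ * extBeta σ x₂ y₂ ^ α₂ := by
  intro x₁ y₁ x₂ y₂ α₁ α₂ hx₁ hy₁ hx₂ hy₂ hα₁ hα₂ hα
  have hnonneg (x y : ℝ) : 0 ≤ᵐ[volume.restrict (Ioo 0 1)] extBetaIntegrand σ x y :=
    (ae_restrict_mem measurableSet_Ioo).mono fun t ht => extBetaIntegrand_nonneg σ x y ht
  simp only [extBeta_eq_setIntegral]
  rw [setIntegral_congr_fun measurableSet_Ioo fun t ht => extBetaIntegrand_convexComb ht hα]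
  exact integral_rpow_mul_rpow_le hα₁ hα₂ hα (integrableOn_extBetaIntegrand hσ hx₁ hy₁)
    (integrableOn_extBetaIntegrand hσ hx₂ hy₂) (hnonneg x₁ y₁) (hnonneg x₂ y₂)
end

section
/- Let a > 0, c > b > 0 and x ∈ (0, 1) be fixed. Then the function σ ↦ F_σ(a, b; c; x) is log-convex on (0, ∞); that is, for all σ₁, σ₂ > 0 and α ∈ [0, 1], F_{α σ₁ + (1−α) σ₂}(a, b; c; x) ≤ (F_{σ₁}(a, b; c; x))^α · (F_{σ₂}(a, b; c; x))^{1−α}. -/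
open Real intervalIntegral

/-- The classical Euler beta function. -/
noncomputable def classicalBeta (u v : ℝ) : ℝ :=
  Real.Gamma u * Real.Gamma v / Real.Gamma (u + v)

/-- The extended Gaussian hypergeometric function. -/
noncomputable def extGHF (σ a b c x : ℝ) : ℝ :=
  (1 / classicalBeta b (c - b)) *
    ∫ t in (0:ℝ)..1, t ^ (b - 1) * (1 - t) ^ (c - b - 1) * (1 - x * t) ^ (-a) *
      Real.exp (-σ / (t * (1 - t)))

/-- Hölder's inequality for a weighted geometric mean of two nonnegative integrable functions. -/
theorem integral_rpow_mul_rpow_one_sub_le {X : Type*} [MeasurableSpace X]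
    {μ : MeasureTheory.Measure X} {f g : X → ℝ} (hf0 : 0 ≤ᵐ[μ] f) (hg0 : 0 ≤ᵐ[μ] g)
    (hf : MeasureTheory.Integrable f μ) (hg : MeasureTheory.Integrable g μ)
    {α : ℝ} (h0 : 0 < α) (h1 : α < 1) :
    ∫ t, f t ^ α * g t ^ (1 - α) ∂μ ≤ (∫ t, f t ∂μ) ^ α * (∫ t, g t ∂μ) ^ (1 - α) := by
  have memLp_rpow : ∀ {h : X → ℝ} {β : ℝ}, 0 ≤ᵐ[μ] h → MeasureTheory.Integrable h μ → 0 < β →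
      MeasureTheory.MemLp (fun t => h t ^ β) (ENNReal.ofReal β⁻¹) μ := by
    intro h β hh hi hβ
    have key := (MeasureTheory.memLp_one_iff_integrable.2 hi).norm_rpow_div (ENNReal.ofReal β)
    rw [ENNReal.toReal_ofReal hβ.le, one_div, ← ENNReal.ofReal_inv_of_pos hβ] at key
    refine key.ae_eq ?_
    filter_upwards [hh] with t ht
    rw [Real.norm_of_nonneg ht]
  have rpow_cancel : ∀ {h : X → ℝ} {β : ℝ}, 0 ≤ᵐ[μ] h → 0 < β →
      ∫ t, (h t ^ β) ^ β⁻¹ ∂μ = ∫ t, h t ∂μ := by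
    intro h β hh hβ
    refine MeasureTheory.integral_congr_ae ?_
    filter_upwards [hh] with t ht
    exact Real.rpow_rpow_inv ht hβ.ne'
  have h1' : 0 < 1 - α := sub_pos.2 h1
  have hpq : (α⁻¹).HolderConjugate (1 - α)⁻¹ :=
    Real.holderConjugate_iff.2 ⟨(one_lt_inv₀ h0).2 h1, by simp⟩
  have key := MeasureTheory.integral_mul_le_Lp_mul_Lq_of_nonneg hpq
    (hf0.mono fun t ht => Real.rpow_nonneg ht α)
    (hg0.mono fun t ht => Real.rpow_nonneg ht (1 - α))
    (memLp_rpow hf0 hf h0) (memLp_rpow hg0 hg h1')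
  simpa only [rpow_cancel hf0 h0, rpow_cancel hg0 h1', one_div, inv_inv] using key

/-- The integrand of the real beta integral is integrable on the open unit interval. -/
theorem integrableOn_rpow_mul_one_sub_rpow_s17 {u v : ℝ} (hu : 0 < u) (hv : 0 < v) :
    MeasureTheory.IntegrableOn (fun t : ℝ => t ^ (u - 1) * (1 - t) ^ (v - 1))
      (Set.Ioo 0 1) := by
  have h := Complex.betaIntegral_convergent (u := u) (v := v) (by simpa) (by simpa)
  rw [intervalIntegrable_iff_integrableOn_Ioo_of_le zero_le_one] at h
  refine MeasureTheory.IntegrableOn.congr_fun h.norm (fun t ht => ?_) measurableSet_Ioo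
  have ht1 : 0 < 1 - t := sub_pos.2 ht.2
  have e : (1 - t : ℂ) = ((1 - t : ℝ) : ℂ) := by push_cast; rfl
  simp only [norm_mul]
  rw [e, Complex.norm_cpow_eq_rpow_re_of_pos ht.1, Complex.norm_cpow_eq_rpow_re_of_pos ht1]
  simp

/-- The integrand of the extended Gaussian hypergeometric function. -/
noncomputable def extGHFIntegrand (σ a b c x t : ℝ) : ℝ :=
  t ^ (b - 1) * (1 - t) ^ (c - b - 1) * (1 - x * t) ^ (-a) * Real.exp (-σ / (t * (1 - t)))

theorem one_sub_mul_pos {x t : ℝ} (hx : x < 1) (ht : t ∈ Set.Ioo (0 : ℝ) 1) :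
    0 < 1 - x * t := by
  nlinarith [ht.1, ht.2, mul_pos (sub_pos.2 hx) ht.1]

theorem extGHFIntegrand_nonneg {σ a b c x t : ℝ} (hx : x < 1) (ht : t ∈ Set.Ioo (0 : ℝ) 1) :
    0 ≤ extGHFIntegrand σ a b c x t := by
  have h1 := ht.1
  have h2 := sub_pos.2 ht.2
  have h3 := one_sub_mul_pos hx ht
  unfold extGHFIntegrand
  positivity

theorem integrableOn_extGHFIntegrand {σ a b c x : ℝ} (hσ : 0 ≤ σ) (ha : 0 ≤ a) (hb : 0 < b)
    (hbc : b < c) (hx : x ∈ Set.Ioo (0 : ℝ) 1) :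
    MeasureTheory.IntegrableOn (extGHFIntegrand σ a b c x) (Set.Ioo 0 1) := by
  have h := (integrableOn_rpow_mul_one_sub_rpow_s17 hb (sub_pos.2 hbc)).mul_const ((1 - x) ^ (-a))
  refine h.mono' (by unfold extGHFIntegrand; fun_prop) ?_
  refine MeasureTheory.ae_restrict_of_forall_mem measurableSet_Ioo fun t ht => ?_
  rw [Real.norm_of_nonneg (extGHFIntegrand_nonneg hx.2 ht)]
  have h1 := ht.1
  have h2 := sub_pos.2 ht.2
  have h3 := one_sub_mul_pos hx.2 ht
  have h4 : (1 - x * t) ^ (-a) ≤ (1 - x) ^ (-a) :=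
    Real.rpow_le_rpow_of_nonpos (sub_pos.2 hx.2) (by nlinarith [hx.1, ht.2]) (by linarith)
  have h5 : Real.exp (-σ / (t * (1 - t))) ≤ 1 :=
    Real.exp_le_one_iff.2 (div_nonpos_of_nonpos_of_nonneg (by linarith) (by positivity))
  unfold extGHFIntegrand
  calc _ ≤ t ^ (b - 1) * (1 - t) ^ (c - b - 1) * (1 - x * t) ^ (-a) * 1 := by gcongr
    _ ≤ _ := by rw [mul_one]; gcongr

theorem extGHFIntegrand_convexCombination {σ₁ σ₂ α a b c x t : ℝ} (hx : x < 1)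
    (ht : t ∈ Set.Ioo (0 : ℝ) 1) :
    extGHFIntegrand (α * σ₁ + (1 - α) * σ₂) a b c x t =
      extGHFIntegrand σ₁ a b c x t ^ α * extGHFIntegrand σ₂ a b c x t ^ (1 - α) := by
  have h1 := ht.1
  have h2 := sub_pos.2 ht.2
  have h3 := one_sub_mul_pos hx ht
  unfold extGHFIntegrand
  have hw : 0 < t ^ (b - 1) * (1 - t) ^ (c - b - 1) * (1 - x * t) ^ (-a) := by positivity
  generalize t ^ (b - 1) * (1 - t) ^ (c - b - 1) * (1 - x * t) ^ (-a) = w at hw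
  rw [Real.mul_rpow hw.le (Real.exp_nonneg _), Real.mul_rpow hw.le (Real.exp_nonneg _),
    ← Real.exp_mul, ← Real.exp_mul, mul_mul_mul_comm, ← Real.rpow_add hw, ← Real.exp_add,
    add_sub_cancel, Real.rpow_one]
  congr 2
  ring

theorem extGHF_eq_setIntegral (σ a b c x : ℝ) :
    extGHF σ a b c x =
      (1 / classicalBeta b (c - b)) * ∫ t in Set.Ioo 0 1, extGHFIntegrand σ a b c x t := by
  rw [extGHF, intervalIntegral.integral_of_le zero_le_one,
    MeasureTheory.integral_Ioc_eq_integral_Ioo]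
  rfl

/-- For fixed a, b, c, x, σ ↦ F_σ(a, b; c; x) is log-convex on (0, ∞). -/
theorem extGHF_logConvex_in_sigma (a b c x : ℝ) (ha : 0 < a) (hb : 0 < b) (hbc : b < c)
    (hx : x ∈ Set.Ioo (0:ℝ) 1) :
    ∀ σ₁ σ₂ α : ℝ, 0 < σ₁ → 0 < σ₂ → α ∈ Set.Icc (0:ℝ) 1 →
      extGHF (α * σ₁ + (1 - α) * σ₂) a b c x ≤
        extGHF σ₁ a b c x ^ α * extGHF σ₂ a b c x ^ (1 - α) := by
  intro σ₁ σ₂ α hσ₁ hσ₂ hα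
  rcases hα.1.eq_or_lt with rfl | h0
  · simp
  rcases hα.2.eq_or_lt with rfl | h1
  · simp
  have hK : 0 < 1 / classicalBeta b (c - b) := by
    have h2 := Real.Gamma_pos_of_pos hb
    have h3 := Real.Gamma_pos_of_pos (sub_pos.2 hbc)
    have h4 := Real.Gamma_pos_of_pos (add_pos hb (sub_pos.2 hbc))
    unfold classicalBeta
    positivity
  have nonneg_ae (σ : ℝ) : 0 ≤ᵐ[MeasureTheory.volume.restrict (Set.Ioo 0 1)]
      extGHFIntegrand σ a b c x :=
    MeasureTheory.ae_restrict_of_forall_mem measurableSet_Ioo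
      fun t ht => extGHFIntegrand_nonneg hx.2 ht
  have integral_nonneg (σ : ℝ) : 0 ≤ ∫ t in Set.Ioo 0 1, extGHFIntegrand σ a b c x t :=
    MeasureTheory.integral_nonneg_of_ae (nonneg_ae σ)
  have holder := integral_rpow_mul_rpow_one_sub_le (nonneg_ae σ₁) (nonneg_ae σ₂)
    (integrableOn_extGHFIntegrand hσ₁.le ha.le hb hbc hx)
    (integrableOn_extGHFIntegrand hσ₂.le ha.le hb hbc hx) h0 h1
  simp only [extGHF_eq_setIntegral]
  rw [Real.mul_rpow hK.le (integral_nonneg σ₁), Real.mul_rpow hK.le (integral_nonneg σ₂),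
    mul_mul_mul_comm, ← Real.rpow_add hK, add_sub_cancel, Real.rpow_one,
    MeasureTheory.setIntegral_congr_fun measurableSet_Ioo
      fun t ht => extGHFIntegrand_convexCombination hx.2 ht]
  exact mul_le_mul_of_nonneg_left holder hK.le
end
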